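/- For every Ω ∈ Λ³V* one has tr(K_Ω) = 0 and K_Ω ∘ K_Ω = λ(Ω)·id_V. -/

import Mathlib

open scoped TensorProduct

noncomputable section

/-- The wedge product of alternating forms valued in a commutative algebra,
obtained from `AlternatingMap.domCoprod` (the sum over shuffles, so that the
wedge of covectors is given by a determinant). -/
def wedge {R A M : Type*} [CommRing R] [CommRing A] [Algebra R A]
    [AddCommGroup M] [Module R M] {m n : ℕ}
    (α : AlternatingMap R M A (Fin m)) (β : AlternatingMap R M A (Fin n)) :
    AlternatingMap R M A (Fin (m + n)) :=
  (LinearMap.mul' R A).compAlternatingMap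
    ((α.domCoprod β).domDomCongr finSumFinEquiv)

/-- A linear map regarded as an alternating 1-form. -/
def oneForm {R A M : Type*} [CommRing R] [CommRing A] [Algebra R A]
    [AddCommGroup M] [Module R M] (ξ : M →ₗ[R] A) : AlternatingMap R M A (Fin 1) :=
  AlternatingMap.ofSubsingleton R M A 0 ξ

/-- A 3-form is decomposable if it is the wedge of three covectors. -/
def IsDecomposable {R A M : Type*} [CommRing R] [CommRing A] [Algebra R A]
    [AddCommGroup M] [Module R M] (α : AlternatingMap R M A (Fin 3)) : Prop :=
  ∃ ξ₁ ξ₂ ξ₃ : M →ₗ[R] A,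
    α = wedge (oneForm ξ₁) (wedge (oneForm ξ₂) (oneForm ξ₃))

open Equiv in
theorem modSum_sum {m n N : ℕ} (σ : Fin N → Perm (Fin m ⊕ Fin n))
    (hN : N * (m.factorial * n.factorial) = (m + n).factorial)
    (hσ : ∀ i j, i ≠ j → ∃ x : Fin m, ∀ y : Fin m, σ j (Sum.inl x) ≠ σ i (Sum.inl y))
    (f : Perm.ModSumCongr (Fin m) (Fin n) → ℂ) :
    ∑ q, f q = ∑ i, f (Quotient.mk'' (σ i)) := by
  symm
  refine Function.Bijective.sum_comp (e := fun i => (Quotient.mk'' (σ i) : Perm.ModSumCongr (Fin m) (Fin n))) ?_ f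
  rw [Fintype.bijective_iff_injective_and_card]
  constructor
  · intro i j h
    by_contra hij
    obtain ⟨x, hx⟩ := hσ i j hij
    have h' := QuotientGroup.eq.1 h
    obtain ⟨⟨a, b⟩, hab⟩ := h'
    apply hx (a x)
    have : σ j = σ i * Perm.sumCongrHom _ _ (a, b) := by rw [hab]; simp
    rw [this]
    simp
  · have h1 := Subgroup.card_eq_card_quotient_mul_card_subgroup
      (Perm.sumCongrHom (Fin m) (Fin n)).range
    have h2 : Nat.card (Perm.sumCongrHom (Fin m) (Fin n)).range = m.factorial * n.factorial := by
      rw [← Nat.card_congr (MonoidHom.ofInjective Perm.sumCongrHom_injective).toEquiv]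
      simp [Fintype.card_perm]
    rw [h2, Nat.card_eq_fintype_card, Fintype.card_perm] at h1
    simp only [Fintype.card_sum, Fintype.card_fin] at h1
    rw [← hN] at h1
    have h3 := Nat.eq_of_mul_eq_mul_right (by positivity) h1
    rw [Fintype.card_fin, h3, Nat.card_eq_fintype_card]
    exact Fintype.card_congr (Equiv.refl _)

open Equiv in
theorem wedge_apply_reps {V : Type*} [AddCommGroup V] [Module ℂ V] {m n N : ℕ}
    (σ : Fin N → Perm (Fin m ⊕ Fin n))
    (hN : N * (m.factorial * n.factorial) = (m + n).factorial)
    (hσ : ∀ i j, i ≠ j → ∃ x : Fin m, ∀ y : Fin m, σ j (Sum.inl x) ≠ σ i (Sum.inl y))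
    (α : AlternatingMap ℂ V ℂ (Fin m)) (β : AlternatingMap ℂ V ℂ (Fin n))
    (v : Fin (m + n) → V) :
    wedge α β v = ∑ i, ((Perm.sign (σ i) : ℤ) : ℂ) *
      (α (fun x => v (finSumFinEquiv (σ i (Sum.inl x)))) *
        β (fun x => v (finSumFinEquiv (σ i (Sum.inr x))))) := by
  unfold wedge
  rw [LinearMap.compAlternatingMap_apply, AlternatingMap.domDomCongr_apply,
    AlternatingMap.domCoprod_apply, _root_.sum_apply, map_sum, modSum_sum σ hN hσ]
  refine Finset.sum_congr rfl fun i _ => ?_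
  rw [AlternatingMap.domCoprod.summand_mk'']
  rw [_root_.smul_apply]
  rcases Int.units_eq_one_or (Perm.sign (σ i)) with h | h <;> simp [h]

/-- The transposition products representing the (2,3)-shuffles. -/
def shuf (i : Fin 10) : Equiv.Perm (Fin 2 ⊕ Fin 3) :=
  Equiv.swap (finSumFinEquiv.symm (0 : Fin 5))
      (finSumFinEquiv.symm ((![0, 0, 0, 0, 1, 1, 1, 2, 2, 3] : Fin 10 → Fin 5) i)) *
    Equiv.swap (finSumFinEquiv.symm (1 : Fin 5))
      (finSumFinEquiv.symm ((![1, 2, 3, 4, 2, 3, 4, 3, 4, 4] : Fin 10 → Fin 5) i))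

theorem wedge_two_three {V : Type*} [AddCommGroup V] [Module ℂ V]
    (α : AlternatingMap ℂ V ℂ (Fin 2)) (β : AlternatingMap ℂ V ℂ (Fin 3))
    (v : Fin 5 → V) :
    wedge α β v = α ![v 0, v 1] * β ![v 2, v 3, v 4] - α ![v 0, v 2] * β ![v 1, v 3, v 4]
      - α ![v 0, v 3] * β ![v 2, v 1, v 4] - α ![v 0, v 4] * β ![v 2, v 3, v 1]
      + α ![v 1, v 2] * β ![v 0, v 3, v 4] + α ![v 1, v 3] * β ![v 2, v 0, v 4]
      + α ![v 1, v 4] * β ![v 2, v 3, v 0] + α ![v 2, v 3] * β ![v 0, v 1, v 4]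
      + α ![v 2, v 4] * β ![v 0, v 3, v 1] + α ![v 3, v 4] * β ![v 2, v 0, v 1] := by
  rw [wedge_apply_reps shuf (by decide) (by decide) α β v]
  have hs : ∀ i, Equiv.Perm.sign (shuf i) =
      (![1, -1, -1, -1, 1, 1, 1, 1, 1, 1] : Fin 10 → ℤˣ) i := by decide
  have hl : ∀ i, (fun x => v (finSumFinEquiv (shuf i (Sum.inl x)))) =
      ![v ((![0, 0, 0, 0, 1, 1, 1, 2, 2, 3] : Fin 10 → Fin 5) i),
        v ((![1, 2, 3, 4, 2, 3, 4, 3, 4, 4] : Fin 10 → Fin 5) i)] := by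
    intro i
    funext x
    revert i x
    have : ∀ i x, finSumFinEquiv (shuf i (Sum.inl x)) =
      (![((![0, 0, 0, 0, 1, 1, 1, 2, 2, 3] : Fin 10 → Fin 5) i),
        ((![1, 2, 3, 4, 2, 3, 4, 3, 4, 4] : Fin 10 → Fin 5) i)] : Fin 2 → Fin 5) x := by decide
    intro i x
    rw [this]
    fin_cases x <;> rfl
  have hr : ∀ i, (fun x => v (finSumFinEquiv (shuf i (Sum.inr x)))) =
      ![v ((![2, 1, 2, 2, 0, 2, 2, 0, 0, 2] : Fin 10 → Fin 5) i),
        v ((![3, 3, 1, 3, 3, 0, 3, 1, 3, 0] : Fin 10 → Fin 5) i),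
        v ((![4, 4, 4, 1, 4, 4, 0, 4, 1, 1] : Fin 10 → Fin 5) i)] := by
    intro i
    funext x
    revert i x
    have : ∀ i x, finSumFinEquiv (shuf i (Sum.inr x)) =
      (![((![2, 1, 2, 2, 0, 2, 2, 0, 0, 2] : Fin 10 → Fin 5) i),
        ((![3, 3, 1, 3, 3, 0, 3, 1, 3, 0] : Fin 10 → Fin 5) i),
        ((![4, 4, 4, 1, 4, 4, 0, 4, 1, 1] : Fin 10 → Fin 5) i)] : Fin 3 → Fin 5) x := by decide
    intro i x
    rw [this]
    fin_cases x <;> rfl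
  simp only [hs, hl, hr]
  simp [Fin.sum_univ_succ]
  ring

set_option maxRecDepth 10000 in
theorem wedge_one_five {V : Type*} [AddCommGroup V] [Module ℂ V]
    (θ : V →ₗ[ℂ] ℂ) (β : AlternatingMap ℂ V ℂ (Fin 5))
    (v : Fin 6 → V) (i : Fin 6) (hθ : ∀ k, θ (v k) = if k = i then 1 else 0) :
    wedge (oneForm θ) β v = (if i = 0 then 1 else -1) *
      β (fun x : Fin 5 => v (Equiv.swap 0 i x.succ)) := by
  rw [wedge_apply_reps (N := 6)
    (fun i : Fin 6 => Equiv.swap (Sum.inl 0) (finSumFinEquiv.symm i : Fin 1 ⊕ Fin 5))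
    (by decide) (by decide) (oneForm θ) β v]
  have hl : ∀ k : Fin 6, oneForm θ (fun x => v (finSumFinEquiv (Equiv.swap (Sum.inl 0)
      (finSumFinEquiv.symm k : Fin 1 ⊕ Fin 5) (Sum.inl x)))) = if k = i then 1 else 0 := by
    intro k
    rw [← hθ]
    simp [oneForm]
  rw [Finset.sum_eq_single i]
  · rw [hl]
    have h1 : ∀ i : Fin 6, Equiv.Perm.sign (Equiv.swap (Sum.inl 0)
        (finSumFinEquiv.symm i : Fin 1 ⊕ Fin 5)) = if i = 0 then 1 else -1 := by decide
    have h2 : ∀ (i : Fin 6) (x : Fin 5), finSumFinEquiv (Equiv.swap (Sum.inl 0)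
      (finSumFinEquiv.symm i : Fin 1 ⊕ Fin 5) (Sum.inr x)) = Equiv.swap 0 i x.succ := by decide
    simp only [h1, h2]
    split_ifs <;> simp
  · intro k _ hk
    rw [hl]
    simp [hk]
  · simp

/-- The value of `ι(e_j)Ω ∧ Ω` on five basis vectors, in coordinates. -/
def wform (a : Fin 6 → Fin 6 → Fin 6 → ℂ) (j : Fin 6) (v : Fin 5 → Fin 6) : ℂ :=
  a j (v 0) (v 1) * a (v 2) (v 3) (v 4) - a j (v 0) (v 2) * a (v 1) (v 3) (v 4)
      - a j (v 0) (v 3) * a (v 2) (v 1) (v 4) - a j (v 0) (v 4) * a (v 2) (v 3) (v 1)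
      + a j (v 1) (v 2) * a (v 0) (v 3) (v 4) + a j (v 1) (v 3) * a (v 2) (v 0) (v 4)
      + a j (v 1) (v 4) * a (v 2) (v 3) (v 0) + a j (v 2) (v 3) * a (v 0) (v 1) (v 4)
      + a j (v 2) (v 4) * a (v 0) (v 3) (v 1) + a j (v 3) (v 4) * a (v 2) (v 0) (v 1)

/-- The matrix of `K_Ω` (up to the normalisation of the volume form). -/
def kmat (a : Fin 6 → Fin 6 → Fin 6 → ℂ) (i j : Fin 6) : ℂ :=
  (if i = 0 then 1 else -1) * wform a j (fun x => Equiv.swap 0 i x.succ)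

set_option maxRecDepth 100000 in
theorem wedge_eq_kmat {V : Type*} [AddCommGroup V] [Module ℂ V]
    (b : Module.Basis (Fin 6) ℂ V) (Ω : AlternatingMap ℂ V ℂ (Fin 3)) (i j : Fin 6) :
    (wedge (oneForm (b.coord i)) (wedge (Ω.curryLeft (b j)) Ω) : AlternatingMap ℂ V ℂ (Fin 6)) b =
      kmat (fun p q r => Ω ![b p, b q, b r]) i j := by
  have h := wedge_one_five (b.coord i) (wedge (Ω.curryLeft (b j)) Ω) b i (by
    intro k
    simp [Finsupp.single_apply])
  refine h.trans ?_
  rw [kmat]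
  congr 1
  refine (wedge_two_three _ _ _).trans ?_
  simp only [AlternatingMap.curryLeft_apply_apply]
  rfl

set_option maxHeartbeats 4000000 in
theorem kmat_facts (a : Fin 6 → Fin 6 → Fin 6 → ℂ)
    (h12 : ∀ i j k, a i j k = - a j i k) (h23 : ∀ i j k, a i j k = - a i k j) :
    (∑ i, kmat a i i = 0) ∧
      ∀ i j, ∑ k, kmat a i k * kmat a k j =
        if i = j then ∑ k, kmat a 0 k * kmat a k 0 else 0 := by
  have z12 : ∀ i k, a i i k = 0 := fun i k => self_eq_neg.1 (h12 i i k)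
  have z23 : ∀ i k, a i k k = 0 := fun i k => self_eq_neg.1 (h23 i k k)
  have s12 : ∀ i j k, j < i → a i j k = - a j i k := fun i j k _ => h12 i j k
  have s23 : ∀ i j k, k < j → a i j k = - a i k j := fun i j k _ => h23 i j k
  constructor
  · rw [Fin.sum_univ_six]
    simp (decide := true) [kmat, wform, Equiv.swap_apply_def, z12, z23, s12, s23]
    ring
  · intro i j
    rw [Fin.sum_univ_six, Fin.sum_univ_six]
    fin_cases i <;> fin_cases j <;>
    (simp (decide := true) [kmat, wform, Equiv.swap_apply_def, z12, z23, s12, s23]; try ring)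

theorem three_swap {V : Type*} [AddCommGroup V] [Module ℂ V]
    (Ω : AlternatingMap ℂ V ℂ (Fin 3)) (x y z : V) :
    Ω ![x, y, z] = - Ω ![y, x, z] ∧ Ω ![x, y, z] = - Ω ![x, z, y] := by
  constructor
  · have h := Ω.map_swap ![y, x, z] (i := 0) (j := 1) (by decide)
    rw [← h]
    congr 1
    funext t
    fin_cases t <;> rfl
  · have h := Ω.map_swap ![x, z, y] (i := 1) (j := 2) (by decide)
    rw [← h]
    congr 1
    funext t
    fin_cases t <;> rfl

/-- For every `Ω ∈ Λ³V*` (V a 6-dimensional complex vector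
space) one has `tr K_Ω = 0` and `K_Ω² = λ(Ω)·id`, where `K_Ω` is characterized
by `θ ∧ ι(v)Ω ∧ Ω = θ(K_Ω v) • ε` and `λ(Ω) = (1/6) tr(K_Ω²)`. -/
theorem stmt2 (V : Type*) [AddCommGroup V] [Module ℂ V] [FiniteDimensional ℂ V]
    (hdim : Module.finrank ℂ V = 6)
    (ε : AlternatingMap ℂ V ℂ (Fin 6)) (hε : ε ≠ 0)
    (K : AlternatingMap ℂ V ℂ (Fin 3) → V →ₗ[ℂ] V)
    (hK : ∀ (Ω : AlternatingMap ℂ V ℂ (Fin 3)) (θ : V →ₗ[ℂ] ℂ) (v : V),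
      wedge (oneForm θ) (wedge (Ω.curryLeft v) Ω) = θ (K Ω v) • ε)
    (Ω : AlternatingMap ℂ V ℂ (Fin 3)) :
    LinearMap.trace ℂ V (K Ω) = 0 ∧
      K Ω ∘ₗ K Ω =
        ((6 : ℂ)⁻¹ * LinearMap.trace ℂ V (K Ω ∘ₗ K Ω)) • (LinearMap.id : V →ₗ[ℂ] V) := by
  let b : Module.Basis (Fin 6) ℂ V := Module.finBasisOfFinrankEq ℂ V hdim
  have hE : ε b ≠ 0 := by
    intro h
    exact hε (ε.map_basis_eq_zero_iff b |>.1 h)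
  obtain ⟨ht, hq⟩ := kmat_facts (fun p q r => Ω ![b p, b q, b r])
    (fun _ _ _ => (three_swap Ω _ _ _).1) (fun _ _ _ => (three_swap Ω _ _ _).2)
  generalize ha : (fun p q r => Ω ![b p, b q, b r]) = a at ht hq
  have hM : ∀ i j, LinearMap.toMatrix b b (K Ω) i j = (ε b)⁻¹ * kmat a i j := by
    intro i j
    have h := wedge_eq_kmat b Ω i j
    rw [hK Ω (b.coord i) (b j), ha] at h
    rw [LinearMap.toMatrix_apply, ← h]
    simp only [AlternatingMap.smul_apply, smul_eq_mul, Module.Basis.coord_apply]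
    field_simp
  refine ⟨?_, ?_⟩
  · rw [LinearMap.trace_eq_matrix_trace ℂ b, Matrix.trace]
    simp only [Matrix.diag_apply, hM]
    rw [← Finset.mul_sum, ht, mul_zero]
  · obtain ⟨c, hc⟩ : ∃ c : ℂ, K Ω ∘ₗ K Ω = c • (LinearMap.id : V →ₗ[ℂ] V) := by
      refine ⟨(ε b)⁻¹ * (ε b)⁻¹ * ∑ k, kmat a 0 k * kmat a k 0, ?_⟩
      apply (LinearMap.toMatrix b b).injective
      ext i j
      rw [LinearMap.toMatrix_comp b b b, Matrix.mul_apply, map_smul, LinearMap.toMatrix_id,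
        Matrix.smul_apply, Matrix.one_apply]
      have h1 : ∀ k, LinearMap.toMatrix b b (K Ω) i k * LinearMap.toMatrix b b (K Ω) k j =
          (ε b)⁻¹ * (ε b)⁻¹ * (kmat a i k * kmat a k j) := by
        intro k
        rw [hM, hM]
        ring
      simp only [h1]
      rw [← Finset.mul_sum, hq]
      split_ifs <;> simp
    rw [hc, map_smul, LinearMap.trace_id, hdim]
    congr 1
    simp
    ring
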